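/- Let ξ ∈ C¹([0,T]) with ξ(0) = 0, and let u₀ ∈ C²((0,∞)) be such that u₀' is bounded, u₀' ∈ L¹((0,∞)), u₀' extends continuously to 0, and u₀'' ∈ L^∞((0,∞)). Define N(t) := (1/√t) ∫_0^∞ e^{−(ξ(t)−x)²/(4t)} u₀'(x) dx for t ∈ (0,T]. Then N extends to a continuous function on [0,T], N is differentiable on (0,T] with |N'(t)| ≤ C̄/√t for some constant C̄ and all t ∈ (0,T], and consequently N is Hölder continuous of order 1/2 on [0,T]. -/

import Mathlib

open MeasureTheory Real Set Filter Topology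

lemma integrable_gauss_mul_affine_abs (a b : ℝ) :
    Integrable (fun y : ℝ ↦ exp (-(1 / 4) * y ^ 2) * (a + b * |y|)) := by
  have h0 := (integrable_exp_neg_mul_sq (b := 1 / 4) (by norm_num)).mul_const a
  have h1 := (integrable_mul_exp_neg_mul_sq (b := 1 / 4) (by norm_num)).norm.mul_const b
  refine (h0.add h1).congr (ae_of_all _ fun y ↦ ?_)
  simp only [Pi.add_apply, norm_mul, norm_eq_abs, abs_exp]
  ring

lemma LipschitzWith.integrable_gauss_mul_comp_affine {h : ℝ → ℝ} {M : NNReal}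
    (hh : LipschitzWith M h) (a r : ℝ) :
    Integrable (fun y : ℝ ↦ exp (-(1 / 4) * y ^ 2) * h (a + r * y)) := by
  refine (integrable_gauss_mul_affine_abs (|h 0| + M * |a|) (M * |r|)).mono'
    (Continuous.aestronglyMeasurable
      (by have := hh.continuous; fun_prop)) (ae_of_all _ fun y ↦ ?_)
  rw [norm_mul, norm_eq_abs, abs_exp]
  gcongr
  have h1 := hh.dist_le_mul (a + r * y) 0
  rw [dist_eq, dist_eq, sub_zero] at h1
  have h2 : |a + r * y| ≤ |a| + |r| * |y| := (abs_add_le _ _).trans (by rw [abs_mul])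
  have h3 := abs_sub_abs_le_abs_sub (h (a + r * y)) (h 0)
  have h4 := mul_le_mul_of_nonneg_left h2 M.2
  rw [norm_eq_abs]
  simp only [NNReal.val_eq_coe] at h4
  linarith

/-- Differentiation of a Gaussian average of a Lipschitz function along a moving center `a` and
scale `√t`. -/
lemma LipschitzWith.exists_hasDerivAt_gauss_average {h : ℝ → ℝ} {M : NNReal}
    (hh : LipschitzWith M h) (hd : ∀ x ≠ 0, DifferentiableAt ℝ h x)
    {a : ℝ → ℝ} {a' t : ℝ} (ha : HasDerivAt a a' t) (ht : 0 < t) :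
    ∃ d, HasDerivAt (fun s ↦ ∫ y : ℝ, exp (-(1 / 4) * y ^ 2) * h (a s + √s * y)) d t ∧
      |d| ≤ ∫ y : ℝ, exp (-(1 / 4) * y ^ 2) * (M * |a'| + M * (1 / (2 * √t)) * |y|) := by
  have hr : 0 < √t := sqrt_pos.2 ht
  have hs : HasDerivAt (fun s ↦ √s) (1 / (2 * √t)) t := hasDerivAt_sqrt ht.ne'
  obtain ⟨c₁, hc₁⟩ := ha.hasFDerivAt.isBigO_sub.bound
  obtain ⟨c₂, hc₂⟩ := hs.hasFDerivAt.isBigO_sub.bound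
  let D : ℝ → ℝ := fun y ↦
    exp (-(1 / 4) * y ^ 2) * (deriv h (a t + √t * y) * (a' + 1 / (2 * √t) * y))
  let L : ℝ →L[ℝ] ℝ →L[ℝ] ℝ := ContinuousLinearMap.smulRightL ℝ ℝ ℝ 1
  have hDmeas : AEStronglyMeasurable D := by
    have := measurable_deriv h
    exact Measurable.aestronglyMeasurable (by fun_prop)
  have hDle : ∀ y, |D y| ≤ exp (-(1 / 4) * y ^ 2) * (M * |a'| + M * (1 / (2 * √t)) * |y|) := by
    intro y
    simp only [D]
    rw [abs_mul, abs_exp, abs_mul]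
    gcongr
    have h1 : |deriv h (a t + √t * y)| ≤ M := norm_deriv_le_of_lipschitz hh
    have h2 : |a' + 1 / (2 * √t) * y| ≤ |a'| + 1 / (2 * √t) * |y| :=
      (abs_add_le _ _).trans (by rw [abs_mul, abs_of_pos (by positivity : 0 < 1 / (2 * √t))])
    calc _ ≤ M * (|a'| + 1 / (2 * √t) * |y|) := by gcongr
      _ = _ := by ring
  have hDint : Integrable D :=
    (integrable_gauss_mul_affine_abs _ _).mono' hDmeas (ae_of_all _ hDle)
  have hne : ∀ᵐ y : ℝ, a t + √t * y ≠ 0 := by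
    filter_upwards [Measure.ae_ne volume (-a t / √t)] with y hy h0
    apply hy
    field_simp
    linarith
  have key := hasFDerivAt_integral_of_dominated_loc_of_lip' (𝕜 := ℝ) (μ := volume)
    (F := fun s y ↦ exp (-(1 / 4) * y ^ 2) * h (a s + √s * y)) (x₀ := t)
    (F' := fun y ↦ L (D y))
    (bound := fun y ↦ exp (-(1 / 4) * y ^ 2) * (M * c₁ + M * c₂ * |y|))
    (hc₁.and hc₂)
    (fun s _ ↦ (hh.integrable_gauss_mul_comp_affine _ _).aestronglyMeasurable)
    (hh.integrable_gauss_mul_comp_affine _ _)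
    (L.continuous.comp_aestronglyMeasurable hDmeas)
    (ae_of_all _ fun y s hs ↦ by
      obtain ⟨h1, h2⟩ := hs
      have h3 := hh.dist_le_mul (a s + √s * y) (a t + √t * y)
      rw [dist_eq, dist_eq] at h3
      rw [← mul_sub, norm_mul, norm_eq_abs, abs_exp, mul_assoc, norm_eq_abs, norm_eq_abs]
      rw [norm_eq_abs, norm_eq_abs] at h1 h2
      gcongr
      have h4 : |a s + √s * y - (a t + √t * y)| ≤ |a s - a t| + |√s - √t| * |y| := by
        rw [← abs_mul]
        refine le_trans (le_of_eq ?_) (abs_add_le _ _)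
        ring_nf
      have h5 : |√s - √t| * |y| ≤ c₂ * |s - t| * |y| := by gcongr
      calc _ ≤ _ := h3
        _ ≤ M * (c₁ * |s - t| + c₂ * |s - t| * |y|) := by gcongr; linarith
        _ = _ := by ring)
    (integrable_gauss_mul_affine_abs _ _)
    (hne.mono fun y hy ↦ by
      have h1 := ((hd _ hy).hasDerivAt.comp t (ha.add (hs.mul_const y))).const_mul
        (exp (-(1 / 4) * y ^ 2))
      exact h1.hasFDerivAt)
  refine ⟨∫ y, D y, ?_, ?_⟩
  · rw [hasDerivAt_iff_hasFDerivAt]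
    have := key.2
    rw [ContinuousLinearMap.integral_comp_comm _ hDint] at this
    exact this
  · exact norm_integral_le_of_norm_le (f := D) (integrable_gauss_mul_affine_abs _ _)
      (ae_of_all _ hDle)

lemma hasDerivAt_integral_Ioi_neg {φ : ℝ → ℝ} (hφ : Continuous φ) (hi : Integrable φ) (z : ℝ) :
    HasDerivAt (fun z ↦ ∫ y in Ioi (-z), φ y) (φ (-z)) z := by
  have h1 : (fun z ↦ ∫ y in Ioi (-z), φ y) =
      fun z ↦ (∫ y in Ioi 0, φ y) - ∫ y in (0 : ℝ)..(-z), φ y := by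
    ext z
    rw [← intervalIntegral.integral_interval_add_Ioi (a := 0) (b := -z) hi.integrableOn
      hi.integrableOn]
    ring
  rw [h1]
  have h2 : HasDerivAt (fun u ↦ ∫ y in (0 : ℝ)..u, φ y) (φ (-z)) (-z) :=
    intervalIntegral.integral_hasDerivAt_right (hφ.intervalIntegrable _ _)
      (hφ.stronglyMeasurableAtFilter _ _) hφ.continuousAt
  simpa using (h2.comp z (hasDerivAt_neg z)).const_sub (∫ y in Ioi 0, φ y)

lemma integral_comp_add_mul_of_pos (G : ℝ → ℝ) (a : ℝ) {r : ℝ} (hr : 0 < r) :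
    ∫ y, G (a + r * y) = (1 / r) * ∫ x, G x := by
  rw [Measure.integral_comp_mul_left (fun x ↦ G (a + x)) r, integral_add_left_eq_self G a,
    abs_of_pos (inv_pos.2 hr), smul_eq_mul, one_div]

/-- A function which is Lipschitz on `(0, ∞)` is there the sum of a constant and of a Lipschitz
function on `ℝ` that vanishes on `(-∞, 0]`. -/
lemma LipschitzOnWith.exists_lipschitzWith_eq_add_const {f : ℝ → ℝ} {M : NNReal}
    (hf : LipschitzOnWith M f (Ioi 0)) :
    ∃ (h : ℝ → ℝ) (c : ℝ), LipschitzWith M h ∧ (∀ x ≤ 0, h x = 0) ∧ ∀ x > 0, f x = h x + c := by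
  obtain ⟨g, hg, hfg⟩ := hf.extend_real
  refine ⟨fun x ↦ g (max x 0) - g 0, g 0, ?_, fun x hx ↦ by simp [max_eq_right hx],
    fun x hx ↦ by simp [max_eq_left hx.le, hfg hx]⟩
  have h1 : LipschitzWith M fun x : ℝ ↦ g (max x 0) := by
    simpa using! hg.comp (LipschitzWith.id.max_const (0 : ℝ))
  refine LipschitzWith.of_dist_le_mul fun x y ↦ ?_
  simpa [dist_eq] using h1.dist_le_mul x y

lemma gauss_half_line_eq {f h : ℝ → ℝ} {M : NNReal} {c : ℝ} (hh : LipschitzWith M h)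
    (h0 : ∀ x ≤ 0, h x = 0) (hf : ∀ x > 0, f x = h x + c) (a : ℝ) {t : ℝ} (ht : 0 < t) :
    (1 / √t) * ∫ x in Ioi (0 : ℝ), exp (-((a - x) ^ 2 / (4 * t))) * f x =
      (∫ y : ℝ, exp (-(1 / 4) * y ^ 2) * h (a + √t * y)) +
        c * ∫ y in Ioi (-(a / √t)), exp (-(1 / 4) * y ^ 2) := by
  have hr : 0 < √t := sqrt_pos.2 ht
  have hi := integrable_exp_neg_mul_sq (b := 1 / 4) (by norm_num)
  rw [← integral_indicator measurableSet_Ioi, ← integral_comp_add_mul_of_pos _ a hr,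
    ← integral_indicator measurableSet_Ioi, ← integral_const_mul,
    ← integral_add (hh.integrable_gauss_mul_comp_affine _ _)
      ((hi.indicator measurableSet_Ioi).const_mul c)]
  congr 1 with y
  have hmem : y ∈ Ioi (-(a / √t)) ↔ a + √t * y ∈ Ioi (0 : ℝ) := by
    rw [mem_Ioi, mem_Ioi, ← neg_div, div_lt_iff₀ hr]
    constructor <;> intro <;> linarith
  have hexp : -((a - (a + √t * y)) ^ 2 / (4 * t)) = -(1 / 4) * y ^ 2 := by
    have := sq_sqrt ht.le
    field_simp
    rw [show a - (a + √t * y) = -(√t * y) by ring, neg_sq, mul_pow, this]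
    ring
  by_cases hy : a + √t * y ∈ Ioi (0 : ℝ)
  · rw [indicator_of_mem hy, indicator_of_mem (hmem.2 hy), hexp, hf _ hy]
    ring
  · rw [indicator_of_notMem hy, indicator_of_notMem (mt hmem.1 hy), h0 _ (not_lt.1 hy)]
    simp

/-- A derivative bound `C / √t` on `(0, T]` makes the function Lipschitz in the variable `√t`. -/
lemma lipschitzOnWith_comp_sq_of_hasDerivWithinAt {N : ℝ → ℝ} {T : ℝ} {C : NNReal}
    (hN : ∀ t ∈ Ioc 0 T, ∃ d, HasDerivWithinAt N d (Ioc 0 T) t ∧ |d| ≤ C / √t) :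
    LipschitzOnWith (2 * C) (fun r ↦ N (r ^ 2)) (Ioc 0 √T) := by
  choose! d hd hdle using hN
  have hmap : MapsTo (fun r : ℝ ↦ r ^ 2) (Ioc 0 √T) (Ioc 0 T) := fun r hr ↦
    ⟨pow_pos hr.1 2, (le_sqrt' hr.1).1 hr.2⟩
  refine (convex_Ioc 0 √T).lipschitzOnWith_of_nnnorm_hasDerivWithin_le
    (f' := fun r ↦ d (r ^ 2) * (2 * r)) (fun r hr ↦ ?_) fun r hr ↦ ?_
  · have h1 : HasDerivWithinAt (fun r : ℝ ↦ r ^ 2) (2 * r) (Ioc 0 √T) r := by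
      simpa using (hasDerivAt_pow 2 r).hasDerivWithinAt
    exact HasDerivWithinAt.comp (h₂ := N) (h := fun r : ℝ ↦ r ^ 2) r (hd _ (hmap hr)) h1 hmap
  · have h1 := hdle _ (hmap hr)
    have hr0 : 0 < r := hr.1
    rw [sqrt_sq hr0.le] at h1
    rw [← NNReal.coe_le_coe, coe_nnnorm, norm_eq_abs, abs_mul,
      abs_of_pos (by positivity : 0 < 2 * r)]
    push_cast
    calc _ ≤ C / r * (2 * r) := by gcongr
      _ = _ := by field_simp

lemma abs_sqrt_sub_sqrt_le {s t : ℝ} (hs : 0 ≤ s) (ht : 0 ≤ t) : |√s - √t| ≤ √|s - t| := by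
  refine le_sqrt_of_sq_le ?_
  have h1 : s - t = (√s - √t) * (√s + √t) := by
    nlinarith [sq_sqrt hs, sq_sqrt ht]
  rw [h1, abs_mul, sq]
  refine mul_le_mul_of_nonneg_left ?_ (abs_nonneg _)
  have := sqrt_nonneg s
  have := sqrt_nonneg t
  rw [abs_of_nonneg (by positivity : 0 ≤ √s + √t), abs_le]
  constructor <;> linarith

/-- For `ξ ∈ C¹([0,T])` with `ξ(0) = 0` and `u₀ ∈ C²((0,∞))` with
`u₀'` bounded, integrable on `(0,∞)`, continuously extendable to `0`, and `u₀''`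
essentially bounded, the function
`N(t) = (1/√t) ∫_0^∞ e^{-(ξ(t)-x)²/(4t)} u₀'(x) dx` extends continuously to `[0,T]`,
is differentiable on `(0,T]` with `|N'(t)| ≤ C̄/√t`, and is Hölder continuous of order
`1/2` on `[0,T]`. -/
theorem stmt14 (T : ℝ) (hT : 0 < T)
    (ξ ξ' : ℝ → ℝ)
    (hξderiv : ∀ t ∈ Set.Icc (0:ℝ) T, HasDerivAt ξ (ξ' t) t)
    (hξ'cont : ContinuousOn ξ' (Set.Icc 0 T))
    (hξ0 : ξ 0 = 0)
    (u₀ u₀' u₀'' : ℝ → ℝ)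
    (hu₀' : ∀ x : ℝ, 0 < x → HasDerivAt u₀ (u₀' x) x)
    (hu₀'' : ∀ x : ℝ, 0 < x → HasDerivAt u₀' (u₀'' x) x)
    (hu₀'bd : ∃ C : ℝ, ∀ x : ℝ, 0 < x → |u₀' x| ≤ C)
    (hu₀'int : IntegrableOn u₀' (Set.Ioi 0))
    (hu₀'ext : ∃ l : ℝ, Filter.Tendsto u₀' (nhdsWithin 0 (Set.Ioi 0)) (nhds l))
    (hu₀''bd : ∃ C : ℝ, ∀ x : ℝ, 0 < x → |u₀'' x| ≤ C)
    (N : ℝ → ℝ)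
    (hN : ∀ t ∈ Set.Ioc (0:ℝ) T, N t = (1 / Real.sqrt t) *
      ∫ x in Set.Ioi (0:ℝ), Real.exp (-((ξ t - x)^2/(4*t))) * u₀' x) :
    (∃ Next : ℝ → ℝ, ContinuousOn Next (Set.Icc 0 T) ∧
      (∀ t ∈ Set.Ioc (0:ℝ) T, Next t = N t)) ∧
    (∃ C' : ℝ, 0 < C' ∧ ∀ t ∈ Set.Ioc (0:ℝ) T, ∃ d : ℝ,
      HasDerivWithinAt N d (Set.Ioc 0 T) t ∧ |d| ≤ C' / Real.sqrt t) ∧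
    (∃ C : ℝ, 0 ≤ C ∧ ∀ t ∈ Set.Ioc (0:ℝ) T, ∀ t' ∈ Set.Ioc (0:ℝ) T,
      |N t - N t'| ≤ C * |t - t'| ^ ((1:ℝ)/2)) := by
  obtain ⟨B, hB⟩ := hu₀''bd
  have hLip : LipschitzOnWith B.toNNReal u₀' (Ioi 0) :=
    (convex_Ioi (0 : ℝ)).lipschitzOnWith_of_nnnorm_hasDerivWithin_le
      (fun x hx ↦ (hu₀'' x hx).hasDerivWithinAt) fun x hx ↦ by
        rw [← NNReal.coe_le_coe, coe_nnnorm, norm_eq_abs]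
        exact (hB x hx).trans (le_coe_toNNReal B)
  obtain ⟨h, c, hh, h0, hf⟩ := hLip.exists_lipschitzWith_eq_add_const
  set M := B.toNNReal
  have hdiff : ∀ x ≠ 0, DifferentiableAt ℝ h x := by
    intro x hx
    rcases hx.lt_or_gt with hx | hx
    · refine (differentiableAt_const (0 : ℝ)).congr_of_eventuallyEq ?_
      filter_upwards [Iio_mem_nhds hx] with y hy using h0 y (le_of_lt hy)
    · refine ((hu₀'' x hx).differentiableAt.sub_const c).congr_of_eventuallyEq ?_
      filter_upwards [Ioi_mem_nhds hx] with y hy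
      rw [hf y hy]
      ring
  obtain ⟨K, hK⟩ := isCompact_Icc.exists_bound_of_continuousOn hξ'cont
  have hK0 : 0 ≤ K := (norm_nonneg _).trans (hK 0 (left_mem_Icc.2 hT.le))
  have hξle : ∀ t ∈ Icc 0 T, |ξ t| ≤ K * t := by
    intro t ht
    have := (convex_Icc 0 T).norm_image_sub_le_of_norm_hasDerivWithin_le
      (fun x hx ↦ (hξderiv x hx).hasDerivWithinAt) hK (left_mem_Icc.2 hT.le) ht
    simpa [hξ0, abs_of_nonneg ht.1] using this
  let φ : ℝ → ℝ := fun y ↦ exp (-(1 / 4) * y ^ 2)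
  have hφi : Integrable φ := integrable_exp_neg_mul_sq (by norm_num)
  have hφ1 : Integrable fun y ↦ φ y * |y| := by
    simpa only [zero_add, one_mul] using integrable_gauss_mul_affine_abs 0 1
  set I₀ := ∫ y, φ y with hI₀
  set I₁ := ∫ y, φ y * |y| with hI₁
  have hI₀0 : 0 ≤ I₀ := integral_nonneg fun y ↦ (exp_pos _).le
  have hI₁0 : 0 ≤ I₁ := integral_nonneg fun y ↦ mul_nonneg (exp_pos _).le (abs_nonneg y)
  let C : ℝ := M * K * √T * I₀ + M / 2 * I₁ + |c| * (3 / 2 * K) + 1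
  have hC : 0 < C := by positivity
  have hderiv : ∀ t ∈ Ioc 0 T, ∃ d, HasDerivWithinAt N d (Ioc 0 T) t ∧ |d| ≤ C / √t := by
    intro t ht
    have ht0 : 0 < t := ht.1
    have htI : t ∈ Icc 0 T := Ioc_subset_Icc_self ht
    have hr : 0 < √t := sqrt_pos.2 ht0
    have hξt := hξderiv t htI
    have hξ't : |ξ' t| ≤ K := hK t htI
    obtain ⟨d, hd, hdle⟩ := hh.exists_hasDerivAt_gauss_average hdiff hξt ht0
    have hz : HasDerivAt (fun s ↦ ξ s / √s)
        ((ξ' t * √t - ξ t * (1 / (2 * √t))) / √t ^ 2) t :=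
      hξt.div (hasDerivAt_sqrt ht0.ne') hr.ne'
    have hP := ((hasDerivAt_integral_Ioi_neg (φ := φ) (by fun_prop) hφi (ξ t / √t)).comp t
      hz).const_mul c
    set z' := (ξ' t * √t - ξ t * (1 / (2 * √t))) / √t ^ 2
    have hz' : |z'| ≤ 3 / 2 * K / √t := by
      have h1 : |ξ' t * √t - ξ t * (1 / (2 * √t))| ≤ K * √t + K * t * (1 / (2 * √t)) := by
        refine (abs_sub _ _).trans ?_
        rw [abs_mul, abs_mul, abs_of_pos hr, abs_of_pos (by positivity : 0 < 1 / (2 * √t))]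
        gcongr
        exact hξle t htI
      rw [abs_div, abs_of_pos (by positivity : 0 < √t ^ 2)]
      calc _ ≤ (K * √t + K * t * (1 / (2 * √t))) / √t ^ 2 := by gcongr
        _ = (K * √t + K * √t ^ 2 * (1 / (2 * √t))) / √t ^ 2 := by rw [sq_sqrt ht0.le]
        _ = _ := by field_simp; ring
    refine ⟨_, (hd.add hP).hasDerivWithinAt.congr_of_mem (fun s hs ↦ ?_) ht, ?_⟩
    · rw [hN s hs]
      exact gauss_half_line_eq hh h0 hf (ξ s) hs.1
    · have hφle : |φ (-(ξ t / √t))| ≤ 1 := by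
        rw [abs_of_pos (exp_pos _), exp_le_one_iff]
        nlinarith [sq_nonneg (-(ξ t / √t))]
      have hd2 : |d| ≤ (M * K * √T * I₀ + M / 2 * I₁) / √t := by
        refine hdle.trans ?_
        have h1 : ∫ y : ℝ, exp (-(1 / 4) * y ^ 2) * (M * |ξ' t| + M * (1 / (2 * √t)) * |y|) =
            M * |ξ' t| * I₀ + M * (1 / (2 * √t)) * I₁ := by
          rw [hI₀, hI₁, ← integral_const_mul, ← integral_const_mul,
            ← integral_add (hφi.const_mul _) (hφ1.const_mul _)]
          congr 1 with y
          simp only [φ]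
          ring
        have h2 : √t ≤ √T := sqrt_le_sqrt ht.2
        rw [h1, le_div_iff₀ hr]
        calc _ = M * |ξ' t| * √t * I₀ + M / 2 * I₁ := by field_simp
          _ ≤ _ := by gcongr
      refine (abs_add_le _ _).trans ?_
      rw [abs_mul, abs_mul]
      calc |d| + |c| * (|φ (-(ξ t / √t))| * |z'|)
          ≤ (M * K * √T * I₀ + M / 2 * I₁) / √t + |c| * (1 * (3 / 2 * K / √t)) := by gcongr
        _ = (M * K * √T * I₀ + M / 2 * I₁ + |c| * (3 / 2 * K)) / √t := by ring
        _ ≤ C / √t := by gcongr; exact (lt_add_one _).le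
  have hLipN := lipschitzOnWith_comp_sq_of_hasDerivWithinAt (C := ⟨C, hC.le⟩) hderiv
  have hmap : ∀ t ∈ Ioc 0 T, √t ∈ Ioc 0 √T := fun t ht ↦ ⟨sqrt_pos.2 ht.1, sqrt_le_sqrt ht.2⟩
  refine ⟨?_, ⟨C, hC, hderiv⟩, 2 * C, by positivity, fun t ht t' ht' ↦ ?_⟩
  · obtain ⟨g, hg, hgN⟩ := hLipN.extend_real
    refine ⟨fun t ↦ g √t, (hg.continuous.comp continuous_sqrt).continuousOn, fun t ht ↦ ?_⟩
    simpa only [sq_sqrt ht.1.le] using (hgN (hmap t ht)).symm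
  · have h1 := hLipN.dist_le_mul _ (hmap t ht) _ (hmap t' ht')
    simp only [sq_sqrt ht.1.le, sq_sqrt ht'.1.le, dist_eq] at h1
    rw [← sqrt_eq_rpow]
    refine h1.trans ?_
    gcongr
    · exact le_rfl
    · exact abs_sqrt_sub_sqrt_le ht.1.le ht'.1.le
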